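/- Under the smallness condition (1+κ)^{2d} ≤ 1 + Δ²/(2d(1+κ)^{2d-1}) on the attraction strength κ, the sequence c_n is submultiplicative: c_{m+n} ≤ c_m c_n for all m, n ≥ 1. Consequently c_n^{1/n} converges to a limit μ with 2^{-d} ≤ μ ≤ c_1 = 1 + 2dκD(1). -/

import Mathlib

open scoped BigOperators

noncomputable section

/-- Squared Euclidean norm of a lattice point (an integer). -/
def nsq {d : ℕ} (x : Fin d → ℤ) : ℤ := ∑ i, (x i) ^ 2

/-- The pair potential: `U(0) = 1`, `U(x) = -κ` for `|x| = 1`, and `0` otherwise. -/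
def Upot {d : ℕ} (κ : ℝ) (x : Fin d → ℤ) : ℝ :=
  if x = 0 then 1 else if nsq x = 1 then -κ else 0

/-- The product of the step weights `D(w_t - w_{t-1})` along a walk. -/
def stepWeight {d : ℕ} (D : (Fin d → ℤ) → ℝ) {n : ℕ} (w : Fin (n + 1) → Fin d → ℤ) : ℝ :=
  ∏ t : Fin n, D (w t.succ - w t.castSucc)

/-- The interaction weight `∏_{0 ≤ s < t ≤ n} (1 - U(w_s - w_t))` of a walk. -/
def pairWeight {d : ℕ} (κ : ℝ) {n : ℕ} (w : Fin (n + 1) → Fin d → ℤ) : ℝ :=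
  ∏ p ∈ Finset.univ.filter (fun p : Fin (n + 1) × Fin (n + 1) => p.1 < p.2),
    (1 - Upot κ (w p.1 - w p.2))

/-- The connectivity `C_n(x)`: sum over all `n`-step walks from `0` to `x` of the
product of the step weights and of the interaction factors. -/
def conn {d : ℕ} (D : (Fin d → ℤ) → ℝ) (κ : ℝ) (n : ℕ) (x : Fin d → ℤ) : ℝ :=
  ∑' w : {w : Fin (n + 1) → Fin d → ℤ // w 0 = 0 ∧ w (Fin.last n) = x},
    stepWeight D w.1 * pairWeight κ w.1

/-- The total connectivity `c_n = Σ_x C_n(x)`. -/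
def totConn {d : ℕ} (D : (Fin d → ℤ) → ℝ) (κ : ℝ) (n : ℕ) : ℝ :=
  ∑' x : Fin d → ℤ, conn D κ n x

/-- Lattice symmetry of the step weight: invariance under coordinate
permutations and sign flips. -/
def LatticeSymm {d : ℕ} (D : (Fin d → ℤ) → ℝ) : Prop :=
  ∀ (σ : Equiv.Perm (Fin d)) (ε : Fin d → ℤ), (∀ i, ε i = 1 ∨ ε i = -1) →
    ∀ x : Fin d → ℤ, D (fun i => ε i * x (σ i)) = D x

end

section Interaction

variable {d : ℕ} {κ : ℝ}

/-- The interaction factor `1 - U(a - b)` of a pair of sites. -/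
def pairFactor (κ : ℝ) (a b : Fin d → ℤ) : ℝ := 1 - Upot κ (a - b)

lemma pairFactor_self (a : Fin d → ℤ) : pairFactor κ a a = 0 := by
  simp [pairFactor, Upot]

lemma nsq_sub_comm (a b : Fin d → ℤ) : nsq (a - b) = nsq (b - a) := by
  simp only [nsq, Pi.sub_apply]
  exact Finset.sum_congr rfl fun i _ => by ring

lemma nsq_zero : nsq (0 : Fin d → ℤ) = 0 := by
  simp [nsq]

lemma ne_of_nsq_sub_eq_one {a b : Fin d → ℤ} (h : nsq (a - b) = 1) : a ≠ b := by
  rintro rfl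
  simp [nsq_zero] at h

lemma pairFactor_of_adj {a b : Fin d → ℤ} (h : nsq (a - b) = 1) :
    pairFactor κ a b = 1 + κ := by
  have := sub_ne_zero.2 (ne_of_nsq_sub_eq_one h)
  simp [pairFactor, Upot, this, h]

lemma pairFactor_comm (a b : Fin d → ℤ) : pairFactor κ a b = pairFactor κ b a := by
  have h : a - b = 0 ↔ b - a = 0 := by simp only [sub_eq_zero, eq_comm]
  simp only [pairFactor, Upot, nsq_sub_comm a b, h]

lemma pairFactor_nonneg (hκ : 0 ≤ κ) (a b : Fin d → ℤ) : 0 ≤ pairFactor κ a b := by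
  unfold pairFactor Upot
  split_ifs <;> linarith

lemma one_le_pairFactor (hκ : 0 ≤ κ) {a b : Fin d → ℤ} (h : a ≠ b) :
    1 ≤ pairFactor κ a b := by
  rw [pairFactor, Upot, if_neg (sub_ne_zero.2 h)]
  split_ifs <;> linarith

lemma pairFactor_le (a b : Fin d → ℤ) :
    pairFactor κ a b ≤ if nsq (a - b) = 1 then 1 + κ else 1 := by
  split_ifs with h
  · exact (pairFactor_of_adj h).le
  · unfold pairFactor Upot
    split_ifs <;> simp

/-- The lattice points of unit Euclidean norm. -/
def unitVectors (d : ℕ) : Finset (Fin d → ℤ) :=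
  (Finset.univ : Finset (Fin d × Fin 2)).image
    fun p => Pi.single p.1 (if p.2 = 0 then 1 else -1)

lemma card_unitVectors_le : (unitVectors d).card ≤ 2 * d := by
  refine Finset.card_image_le.trans ?_
  simp [mul_comm]

lemma mem_unitVectors {x : Fin d → ℤ} (h : nsq x = 1) : x ∈ unitVectors d := by
  have hx : ∃ i, x i ≠ 0 := by
    by_contra! hc
    simp [nsq, hc] at h
  obtain ⟨i, hi⟩ := hx
  have hsplit : x i ^ 2 + ∑ j ∈ Finset.univ.erase i, x j ^ 2 = 1 := by
    rw [← h, nsq, Finset.add_sum_erase _ (fun j => x j ^ 2) (Finset.mem_univ i)]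
  have h1 : 0 < x i ^ 2 := by positivity
  have h2 : 0 ≤ ∑ j ∈ Finset.univ.erase i, x j ^ 2 :=
    Finset.sum_nonneg fun j _ => sq_nonneg _
  have h3 : ∑ j ∈ Finset.univ.erase i, x j ^ 2 = 0 := by omega
  have h4 : ∀ j, j ≠ i → x j = 0 := fun j hj => by
    have := (Finset.sum_eq_zero_iff_of_nonneg fun j _ => sq_nonneg (x j)).1 h3 j (by simp [hj])
    simpa using this
  have h5 : x i ^ 2 = 1 := by omega
  have hxs : x = Pi.single i (x i) := by
    funext j
    by_cases hj : j = i
    · subst hj; simp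
    · simp [hj, h4 j hj]
  rw [unitVectors, Finset.mem_image]
  rcases mul_self_eq_one_iff.1 ((sq (x i)).symm.trans h5) with h6 | h6
  · exact ⟨(i, 0), Finset.mem_univ _, by rw [hxs, h6]; simp⟩
  · exact ⟨(i, 1), Finset.mem_univ _, by rw [hxs, h6]; simp⟩

lemma card_filter_adj_le (y : Fin d → ℤ) (N : Finset (Fin d → ℤ)) :
    (N.filter fun b => nsq (b - y) = 1).card ≤ 2 * d := by
  refine le_trans ?_ (card_unitVectors_le (d := d))
  refine Finset.card_le_card_of_injOn (fun b => b - y) ?_ ?_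
  · intro b hb
    exact mem_unitVectors (Finset.mem_filter.1 hb).2
  · intro a _ b _ hab
    simpa using hab

lemma prod_pairFactor_le (hκ : 0 ≤ κ) (y : Fin d → ℤ) (N : Finset (Fin d → ℤ)) :
    ∏ b ∈ N, pairFactor κ b y ≤ (1 + κ) ^ (N.filter fun b => nsq (b - y) = 1).card := by
  rw [← Finset.prod_const, Finset.prod_filter]
  exact Finset.prod_le_prod (fun b _ => pairFactor_nonneg hκ b y) fun b _ => pairFactor_le b y

lemma prod_pairFactor_le_pow (hκ : 0 ≤ κ) (y : Fin d → ℤ) (N : Finset (Fin d → ℤ)) :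
    ∏ b ∈ N, pairFactor κ b y ≤ (1 + κ) ^ (2 * d) :=
  (prod_pairFactor_le hκ y N).trans (pow_le_pow_right₀ (by linarith) (card_filter_adj_le y N))

lemma prod_pairFactor_le_pow_pred (hκ : 0 ≤ κ) {x y : Fin d → ℤ} (hxy : nsq (x - y) = 1)
    {N : Finset (Fin d → ℤ)} (hx : x ∉ N) :
    ∏ b ∈ N, pairFactor κ b y ≤ (1 + κ) ^ (2 * d - 1) := by
  refine (prod_pairFactor_le hκ y N).trans (pow_le_pow_right₀ (by linarith) ?_)
  have h := card_filter_adj_le y (insert x N)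
  rw [Finset.filter_insert, if_pos hxy, Finset.card_insert_of_notMem (by simp [hx])] at h
  omega

/-- The interaction of a family of sites with itself. -/
def selfFactor (κ : ℝ) {n : ℕ} (q : Fin n → Fin d → ℤ) : ℝ :=
  ∏ i, ∏ j, if j < i then pairFactor κ (q j) (q i) else 1

/-- The interaction of a family of sites with a finite set of sites. -/
def envFactor (κ : ℝ) (B : Finset (Fin d → ℤ)) {n : ℕ} (q : Fin n → Fin d → ℤ) : ℝ :=
  ∏ a ∈ B, ∏ j, pairFactor κ a (q j)

lemma selfFactor_nonneg (hκ : 0 ≤ κ) {n : ℕ} (q : Fin n → Fin d → ℤ) :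
    0 ≤ selfFactor κ q := by
  refine Finset.prod_nonneg fun i _ => Finset.prod_nonneg fun j _ => ?_
  split_ifs
  exacts [pairFactor_nonneg hκ _ _, zero_le_one]

lemma envFactor_nonneg (hκ : 0 ≤ κ) (B : Finset (Fin d → ℤ)) {n : ℕ}
    (q : Fin n → Fin d → ℤ) : 0 ≤ envFactor κ B q :=
  Finset.prod_nonneg fun _ _ => Finset.prod_nonneg fun _ _ => pairFactor_nonneg hκ _ _

lemma injective_of_selfFactor_ne_zero {n : ℕ} {q : Fin n → Fin d → ℤ}
    (h : selfFactor κ q ≠ 0) : Function.Injective q := by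
  have key : ∀ i j, j < i → q j ≠ q i := fun i j hij heq => by
    refine h (Finset.prod_eq_zero (Finset.mem_univ i) (Finset.prod_eq_zero (Finset.mem_univ j) ?_))
    rw [if_pos hij, heq, pairFactor_self]
  intro i j hij
  by_contra hne
  rcases lt_or_gt_of_ne hne with h1 | h1
  · exact key _ _ h1 hij
  · exact key _ _ h1 hij.symm

lemma notMem_of_envFactor_ne_zero {B : Finset (Fin d → ℤ)} {n : ℕ}
    {q : Fin n → Fin d → ℤ} (h : envFactor κ B q ≠ 0) (j : Fin n) : q j ∉ B := fun hj =>
  h (Finset.prod_eq_zero hj (Finset.prod_eq_zero (Finset.mem_univ j) (pairFactor_self _)))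

lemma one_le_prod_of_one_le {ι : Type*} {s : Finset ι} {f : ι → ℝ} (h : ∀ i ∈ s, 1 ≤ f i) :
    1 ≤ ∏ i ∈ s, f i := by
  simpa using Finset.prod_le_prod (f := fun _ => (1 : ℝ)) (fun _ _ => zero_le_one) h

lemma one_le_selfFactor (hκ : 0 ≤ κ) {n : ℕ} {q : Fin n → Fin d → ℤ}
    (hq : Function.Injective q) : 1 ≤ selfFactor κ q := by
  refine one_le_prod_of_one_le fun i _ => one_le_prod_of_one_le fun j _ => ?_
  split_ifs with hij
  exacts [one_le_pairFactor hκ fun h => hij.ne (hq h), le_rfl]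

lemma pairWeight_eq_selfFactor {n : ℕ} (w : Fin (n + 1) → Fin d → ℤ) :
    pairWeight κ w = selfFactor κ w := by
  rw [pairWeight, Finset.prod_filter, Fintype.prod_prod_type_right]
  rfl

lemma selfFactor_cons {n : ℕ} (v : Fin d → ℤ) (q : Fin n → Fin d → ℤ) :
    selfFactor κ (Fin.cons v q : Fin (n + 1) → Fin d → ℤ) = envFactor κ {v} q * selfFactor κ q := by
  simp [selfFactor, envFactor, Fin.prod_univ_succ, Finset.prod_mul_distrib]

lemma selfFactor_append {m n : ℕ} (p : Fin m → Fin d → ℤ) (q : Fin n → Fin d → ℤ) :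
    selfFactor κ (Fin.append p q) =
      selfFactor κ p * ((∏ i, ∏ j, pairFactor κ (p i) (q j)) * selfFactor κ q) := by
  have h1 : ∀ (i : Fin m) (j : Fin n), ¬ Fin.natAdd m j < Fin.castAdd n i := fun i j => by
    simp [Fin.lt_def]; omega
  have h3 : ∀ i j : Fin m, Fin.castAdd n j < Fin.castAdd n i ↔ j < i := fun i j => Iff.rfl
  have h2 : ∀ (i : Fin m) (j : Fin n), Fin.castAdd n i < Fin.natAdd m j := fun i j => by
    simp [Fin.lt_def]; omega
  simp only [selfFactor, Fin.prod_univ_add, Fin.append_left, Fin.append_right, h1, h2, h3,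
    Finset.prod_mul_distrib]
  rw [Finset.prod_comm (f := fun i j => pairFactor κ (p i) (q j))]
  simp [mul_assoc]

lemma selfFactor_le_update (hκ : 0 ≤ κ) {n : ℕ} {q : Fin n → Fin d → ℤ} {x : Fin d → ℤ}
    (t : Fin n) (hxq : ∀ j, q j ≠ x) :
    selfFactor κ q ≤
      selfFactor κ (Function.update q t x) *
        ∏ j ∈ Finset.univ.erase t, pairFactor κ (q j) (q t) := by
  have hprod : ∏ j ∈ Finset.univ.erase t, pairFactor κ (q j) (q t) =
      ∏ i, ∏ j, if j < i then
        (if i = t then pairFactor κ (q j) (q t) else 1) *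
          (if j = t then pairFactor κ (q i) (q t) else 1) else 1 := by
    have h1 : ∀ i j : Fin n, (if j < i then
        (if i = t then pairFactor κ (q j) (q t) else 1) *
          (if j = t then pairFactor κ (q i) (q t) else 1) else 1) =
        (if i = t then (if j < t then pairFactor κ (q j) (q t) else 1) else 1) *
          (if j = t then (if t < i then pairFactor κ (q i) (q t) else 1) else 1) := by
      intro i j
      by_cases hi : i = t
      · subst hi
        by_cases hj : j = i
        · subst hj; simp
        · simp [hj]
      · by_cases hj : j = t
        · subst hj; simp [hi]
        · simp [hi, hj]
    have h2 : ∀ i : Fin n, (∏ j, if i = t then (if j < t then pairFactor κ (q j) (q t) else 1)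
        else 1) = if i = t then ∏ j, (if j < t then pairFactor κ (q j) (q t) else 1) else 1 := by
      intro i
      split_ifs <;> simp
    simp only [h1, Finset.prod_mul_distrib, h2, Finset.prod_ite_eq', Finset.mem_univ, if_true]
    rw [← Finset.prod_mul_distrib, ← Finset.mul_prod_erase _ _ (Finset.mem_univ t)]
    simp only [lt_irrefl, if_false, one_mul]
    refine Finset.prod_congr rfl fun j hj => ?_
    rcases lt_or_gt_of_ne (Finset.ne_of_mem_erase hj) with h | h
    · simp [h, h.not_gt]
    · simp [h, h.not_gt]
  rw [hprod, selfFactor, selfFactor, ← Finset.prod_mul_distrib]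
  simp only [← Finset.prod_mul_distrib]
  refine Finset.prod_le_prod (fun i _ => Finset.prod_nonneg fun j _ => ?_) fun i _ =>
    Finset.prod_le_prod (fun j _ => ?_) fun j _ => ?_
  · split_ifs
    exacts [pairFactor_nonneg hκ _ _, zero_le_one]
  · split_ifs
    exacts [pairFactor_nonneg hκ _ _, zero_le_one]
  · by_cases hij : j < i
    · simp only [hij, if_true]
      by_cases hi : i = t
      · subst hi
        simp only [hij.ne, if_true, if_false, mul_one, Function.update_self, ne_eq,
          not_false_eq_true, Function.update_of_ne]
        exact le_mul_of_one_le_left (pairFactor_nonneg hκ _ _) (one_le_pairFactor hκ (hxq j))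
      · by_cases hj : j = t
        · subst hj
          simp only [hi, if_true, if_false, one_mul, Function.update_self, ne_eq,
            not_false_eq_true, Function.update_of_ne]
          rw [pairFactor_comm (q j)]
          exact le_mul_of_one_le_left (pairFactor_nonneg hκ _ _)
            (one_le_pairFactor hκ (hxq i).symm)
        · simp [hi, hj]
    · simp [hij]

lemma envFactor_le_update (hκ : 0 ≤ κ) {B : Finset (Fin d → ℤ)} {n : ℕ} {q : Fin n → Fin d → ℤ}
    {x : Fin d → ℤ} (t : Fin n) (hxB : x ∉ B) :
    envFactor κ B q ≤ envFactor κ B (Function.update q t x) * ∏ a ∈ B, pairFactor κ a (q t) := by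
  rw [envFactor, envFactor, ← Finset.prod_mul_distrib]
  refine Finset.prod_le_prod
    (fun a _ => Finset.prod_nonneg fun j _ => pairFactor_nonneg hκ _ _) fun a ha => ?_
  rw [← Finset.mul_prod_erase _ _ (Finset.mem_univ t),
    ← Finset.mul_prod_erase _ (fun j => pairFactor κ a (Function.update q t x j))
      (Finset.mem_univ t)]
  have hrest : ∏ j ∈ Finset.univ.erase t, pairFactor κ a (Function.update q t x j) =
      ∏ j ∈ Finset.univ.erase t, pairFactor κ a (q j) :=
    Finset.prod_congr rfl fun j hj => by
      rw [Function.update_of_ne (Finset.ne_of_mem_erase hj)]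
  rw [hrest, Function.update_self, mul_right_comm]
  have hax : a ≠ x := fun h => hxB (h ▸ ha)
  refine mul_le_mul_of_nonneg_right ?_ (Finset.prod_nonneg fun j _ => pairFactor_nonneg hκ _ _)
  exact le_mul_of_one_le_left (pairFactor_nonneg hκ _ _) (one_le_pairFactor hκ hax)

/-- Moving the site `q t` to a free site `x` costs at most the interaction of `q t`. -/
lemma interaction_le_update (hκ : 0 ≤ κ) {B : Finset (Fin d → ℤ)} {n : ℕ}
    {q : Fin n → Fin d → ℤ} {x : Fin d → ℤ} (t : Fin n) (hxB : x ∉ B) (hxq : ∀ j, q j ≠ x)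
    (hadj : nsq (x - q t) = 1) :
    selfFactor κ q * envFactor κ B q ≤
      (selfFactor κ (Function.update q t x) * envFactor κ B (Function.update q t x)) *
        (1 + κ) ^ (2 * d - 1) := by
  have hnn := mul_nonneg (selfFactor_nonneg hκ (Function.update q t x))
    (envFactor_nonneg hκ B (Function.update q t x))
  by_cases h0 : selfFactor κ q * envFactor κ B q = 0
  · rw [h0]
    positivity
  have hinj := injective_of_selfFactor_ne_zero (left_ne_zero_of_mul h0)
  have hnot := notMem_of_envFactor_ne_zero (right_ne_zero_of_mul h0)
  refine (mul_le_mul (selfFactor_le_update hκ t hxq) (envFactor_le_update (x := x) hκ t hxB)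
    (envFactor_nonneg hκ _ _) (mul_nonneg (selfFactor_nonneg hκ _)
      (Finset.prod_nonneg fun _ _ => pairFactor_nonneg hκ _ _))).trans ?_
  rw [mul_mul_mul_comm]
  refine mul_le_mul_of_nonneg_left ?_ hnn
  have hdisj : Disjoint ((Finset.univ.erase t).image q) B := by
    rw [Finset.disjoint_left]
    intro b hb
    obtain ⟨j, _, rfl⟩ := Finset.mem_image.1 hb
    exact hnot j
  rw [← Finset.prod_image (f := fun b => pairFactor κ b (q t)) (g := q) (fun a _ b _ h => hinj h),
    ← Finset.prod_union hdisj]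
  refine prod_pairFactor_le_pow_pred hκ hadj ?_
  simp [hxB, hxq]

end Interaction

section Steps

open ENNReal

variable {d : ℕ} {D : (Fin d → ℤ) → ℝ} {κ Δ : ℝ}

/-- The product of the step weights of the walk that starts at `v` and visits the sites `q`. -/
noncomputable def stepProd (D : (Fin d → ℤ) → ℝ) (v : Fin d → ℤ) {n : ℕ}
    (q : Fin n → Fin d → ℤ) : ℝ :=
  stepWeight D (Fin.cons v q : Fin (n + 1) → Fin d → ℤ)

lemma stepWeight_nonneg (hDnn : ∀ x, 0 ≤ D x) {n : ℕ} (w : Fin (n + 1) → Fin d → ℤ) :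
    0 ≤ stepWeight D w :=
  Finset.prod_nonneg fun _ _ => hDnn _

lemma stepProd_nonneg (hDnn : ∀ x, 0 ≤ D x) (v : Fin d → ℤ) {n : ℕ} (q : Fin n → Fin d → ℤ) :
    0 ≤ stepProd D v q :=
  stepWeight_nonneg hDnn _

lemma stepProd_eq (v : Fin d → ℤ) {n : ℕ} (q : Fin n → Fin d → ℤ) :
    stepProd D v q =
      ∏ i : Fin n, D (q i - (Fin.cons v q : Fin (n + 1) → Fin d → ℤ) i.castSucc) := by
  simp [stepProd, stepWeight]

lemma stepProd_append {m n : ℕ} (v : Fin d → ℤ) (p : Fin m → Fin d → ℤ) (q : Fin n → Fin d → ℤ) :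
    stepProd D v (Fin.append p q) =
      stepProd D v p * stepProd D ((Fin.cons v p : Fin (m + 1) → Fin d → ℤ) (Fin.last m)) q := by
  have h1 : ∀ i : Fin m, (Fin.cons v (Fin.append p q) : Fin (m + n + 1) → Fin d → ℤ)
      (Fin.castAdd n i).castSucc = (Fin.cons v p : Fin (m + 1) → Fin d → ℤ) i.castSucc := by
    rintro ⟨i, hi⟩
    cases i with
    | zero => rfl
    | succ i =>
      have : (⟨i + 1, hi⟩ : Fin m).castSucc = Fin.succ ⟨i, by omega⟩ := rfl
      rw [this, Fin.cons_succ]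
      have : (Fin.castAdd n ⟨i + 1, hi⟩).castSucc = Fin.succ (Fin.castAdd n ⟨i, by omega⟩) := rfl
      rw [this, Fin.cons_succ, Fin.append_left]
  have h2 : ∀ i : Fin n, (Fin.cons v (Fin.append p q) : Fin (m + n + 1) → Fin d → ℤ)
      (Fin.natAdd m i).castSucc =
      (Fin.cons ((Fin.cons v p : Fin (m + 1) → Fin d → ℤ) (Fin.last m)) q :
        Fin (n + 1) → Fin d → ℤ) i.castSucc := by
    rintro ⟨i, hi⟩
    cases i with
    | zero =>
      cases m with
      | zero => rfl
      | succ m =>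
        have : (Fin.natAdd (m + 1) ⟨0, hi⟩).castSucc = Fin.succ (Fin.castAdd n (Fin.last m)) := rfl
        rw [this, Fin.cons_succ, Fin.append_left]
        rfl
    | succ i =>
      have : (Fin.natAdd m ⟨i + 1, hi⟩).castSucc = Fin.succ (Fin.natAdd m ⟨i, by omega⟩) := rfl
      rw [this, Fin.cons_succ, Fin.append_right]
      rfl
  simp only [stepProd_eq, Fin.prod_univ_add, Fin.append_left, Fin.append_right, h1, h2]

lemma stepProd_cons {n : ℕ} (v x : Fin d → ℤ) (q : Fin n → Fin d → ℤ) :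
    stepProd D v (Fin.cons x q : Fin (n + 1) → Fin d → ℤ) = D (x - v) * stepProd D x q := by
  simp [stepProd, stepWeight, Fin.prod_univ_succ]

lemma stepProd_add {n : ℕ} (v : Fin d → ℤ) (q : Fin n → Fin d → ℤ) :
    stepProd D v (fun i => q i + v) = stepProd D 0 q := by
  rw [stepProd_eq, stepProd_eq]
  refine Finset.prod_congr rfl fun i _ => ?_
  rcases i with ⟨i, hi⟩
  cases i with
  | zero => simp
  | succ i =>
    have : (⟨i + 1, hi⟩ : Fin n).castSucc = Fin.succ ⟨i, by omega⟩ := rfl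
    rw [this, Fin.cons_succ, Fin.cons_succ, add_sub_add_right_eq_sub]

lemma step_ratio_le_one (hd : 0 < d) (hDnn : ∀ x, 0 ≤ D x) (hD0 : D 0 = 0) (hsum : HasSum D 1)
    (hΔpos : 0 < Δ) (hΔ : ∀ x y : Fin d → ℤ, nsq (x - y) = 1 → y ≠ 0 → Δ * D x ≤ D y) :
    Δ ≤ 1 := by
  obtain ⟨x, hx⟩ : ∃ x, D x ≠ 0 := by
    by_contra! h
    rw [funext h] at hsum
    exact one_ne_zero (hsum.unique hasSum_zero)
  have hxpos : 0 < D x := lt_of_le_of_ne (hDnn x) hx.symm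
  have hx0 : x ≠ 0 := fun h => hx (h ▸ hD0)
  have hnsq : ∀ s : ℤ, s ^ 2 = 1 → nsq (Pi.single (⟨0, hd⟩ : Fin d) s) = 1 := fun s hs => by
    rw [nsq, Finset.sum_eq_single ⟨0, hd⟩] <;> simp_all
  obtain ⟨y, hy0, hxy⟩ : ∃ y, y ≠ 0 ∧ nsq (x - y) = 1 := by
    by_cases h : x + Pi.single (⟨0, hd⟩ : Fin d) 1 = 0
    · refine ⟨x - Pi.single (⟨0, hd⟩ : Fin d) 1, fun h' => ?_, by simp [hnsq]⟩
      have h1 := congrFun h ⟨0, hd⟩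
      have h2 := congrFun h' ⟨0, hd⟩
      simp at h1 h2
      omega
    · refine ⟨_, h, ?_⟩
      rw [nsq_sub_comm]
      simp [hnsq]
  have h1 := hΔ x y hxy hy0
  have h2 := hΔ y x (by rw [nsq_sub_comm, hxy]) hx0
  by_contra! hc
  nlinarith [mul_le_mul_of_nonneg_left h1 hΔpos.le, mul_pos hxpos hΔpos]

lemma stepProd_le_update (hDnn : ∀ x, 0 ≤ D x) (hΔpos : 0 < Δ) (hΔ1 : Δ ≤ 1)
    (hΔ : ∀ x y : Fin d → ℤ, nsq (x - y) = 1 → y ≠ 0 → Δ * D x ≤ D y) {n : ℕ}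
    {v x : Fin d → ℤ} {q : Fin n → Fin d → ℤ} (t : Fin n) (hxv : x ≠ v) (hxq : ∀ j, q j ≠ x)
    (hadj : nsq (x - q t) = 1) :
    Δ ^ 2 * stepProd D v q ≤ stepProd D v (Function.update q t x) := by
  have hfac : Δ ^ 2 ≤ ∏ i : Fin n,
      ((if i = t then Δ else 1) * (if i.castSucc = t.succ then Δ else 1)) := by
    rw [Finset.prod_mul_distrib, Finset.prod_ite_eq' Finset.univ t, if_pos (Finset.mem_univ t), sq]
    refine mul_le_mul_of_nonneg_left ?_ hΔpos.le
    by_cases h : ∃ k : Fin n, k.castSucc = t.succ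
    · obtain ⟨k, hk⟩ := h
      rw [← hk]
      simp
    · rw [Finset.prod_eq_one fun i _ => if_neg fun hi => h ⟨i, hi⟩]
      exact hΔ1
  refine (mul_le_mul_of_nonneg_right hfac (stepProd_nonneg hDnn v q)).trans ?_
  rw [stepProd_eq, stepProd_eq, ← Finset.prod_mul_distrib]
  have hcons : (Fin.cons v (Function.update q t x) : Fin (n + 1) → Fin d → ℤ) =
      Function.update (Fin.cons v q) t.succ x := (Fin.cons_update ..)
  have hxc : ∀ k, (Fin.cons v q : Fin (n + 1) → Fin d → ℤ) k ≠ x := by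
    refine Fin.cases ?_ fun k => ?_
    · simpa using hxv.symm
    · simpa using hxq k
  rw [hcons]
  refine Finset.prod_le_prod (fun i _ => ?_) fun i _ => ?_
  · refine mul_nonneg ?_ (hDnn _)
    split_ifs <;> positivity
  · by_cases hi : i = t
    · subst hi
      have hne : i.castSucc ≠ i.succ := (Fin.castSucc_lt_succ).ne
      rw [if_pos rfl, if_neg hne, mul_one, Function.update_self, Function.update_of_ne hne]
      refine hΔ _ _ ?_ (sub_ne_zero.2 (hxc _).symm)
      rw [sub_sub_sub_cancel_right, nsq_sub_comm, hadj]
    · by_cases hi' : i.castSucc = t.succ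
      · rw [if_neg hi, if_pos hi', one_mul, hi', Function.update_of_ne hi, Function.update_self,
          Fin.cons_succ]
        refine hΔ _ _ ?_ (sub_ne_zero.2 (hxq _))
        rw [sub_sub_sub_comm, sub_self, zero_sub, neg_sub, hadj]
      · rw [if_neg hi, if_neg hi', one_mul, one_mul, Function.update_of_ne hi,
          Function.update_of_ne hi']

/-- The weight of the walk `q` from `v`, interacting with itself and with the sites of `B`. -/
noncomputable def envWeight (D : (Fin d → ℤ) → ℝ) (κ : ℝ) (B : Finset (Fin d → ℤ))
    (v : Fin d → ℤ) {n : ℕ} (q : Fin n → Fin d → ℤ) : ℝ :=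
  stepProd D v q * (selfFactor κ q * envFactor κ B q)

lemma envWeight_nonneg (hκ : 0 ≤ κ) (hDnn : ∀ x, 0 ≤ D x) (B : Finset (Fin d → ℤ))
    (v : Fin d → ℤ) {n : ℕ} (q : Fin n → Fin d → ℤ) : 0 ≤ envWeight D κ B v q :=
  mul_nonneg (stepProd_nonneg hDnn _ _)
    (mul_nonneg (selfFactor_nonneg hκ _) (envFactor_nonneg hκ _ _))

lemma envWeight_le_update (hκ : 0 ≤ κ) (hDnn : ∀ x, 0 ≤ D x) (hΔpos : 0 < Δ) (hΔ1 : Δ ≤ 1)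
    (hΔ : ∀ x y : Fin d → ℤ, nsq (x - y) = 1 → y ≠ 0 → Δ * D x ≤ D y)
    {B : Finset (Fin d → ℤ)} {n : ℕ} {v x : Fin d → ℤ} {q : Fin n → Fin d → ℤ} (t : Fin n)
    (hvB : v ∈ B) (hxB : x ∉ B) (hxq : ∀ j, q j ≠ x) (hadj : nsq (x - q t) = 1) :
    envWeight D κ B v q * (Δ ^ 2 / (1 + κ) ^ (2 * d - 1)) ≤
      envWeight D κ B v (Function.update q t x) := by
  have hxv : x ≠ v := fun h => hxB (h ▸ hvB)
  have h1 := stepProd_le_update hDnn hΔpos hΔ1 hΔ t hxv hxq hadj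
  have h2 := interaction_le_update hκ t hxB hxq hadj
  have hpos : 0 < (1 + κ) ^ (2 * d - 1) := by positivity
  rw [← mul_div_assoc, div_le_iff₀ hpos]
  have h3 := mul_le_mul h1 h2
    (mul_nonneg (selfFactor_nonneg hκ q) (envFactor_nonneg hκ B q)) (stepProd_nonneg hDnn _ _)
  unfold envWeight
  linarith

lemma envWeight_insert {B : Finset (Fin d → ℤ)} {n : ℕ} {v x : Fin d → ℤ} (hxB : x ∉ B)
    (q : Fin n → Fin d → ℤ) :
    envWeight D κ (insert x B) v q = envWeight D κ B v q * ∏ j, pairFactor κ x (q j) := by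
  rw [envWeight, envWeight, envFactor, Finset.prod_insert hxB, ← envFactor]
  ring

/-- Adding a site `x` to the environment does not increase the total weight of the walks from `v`:
the reward for walks passing next to `x` is paid for by the walks visiting `x`. -/
lemma tsum_envWeight_insert_le (hκ : 0 ≤ κ) (hDnn : ∀ x, 0 ≤ D x) (hΔpos : 0 < Δ) (hΔ1 : Δ ≤ 1)
    (hΔ : ∀ x y : Fin d → ℤ, nsq (x - y) = 1 → y ≠ 0 → Δ * D x ≤ D y) (hd : 0 < d)
    (hsmall : (1 + κ) ^ (2 * d) ≤ 1 + Δ ^ 2 / (2 * d * (1 + κ) ^ (2 * d - 1)))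
    {B : Finset (Fin d → ℤ)} {v x : Fin d → ℤ} (hvB : v ∈ B) (hxB : x ∉ B) (n : ℕ) :
    ∑' q : Fin n → Fin d → ℤ, ENNReal.ofReal (envWeight D κ (insert x B) v q) ≤
      ∑' q : Fin n → Fin d → ℤ, ENNReal.ofReal (envWeight D κ B v q) := by
  classical
  let f : (Fin n → Fin d → ℤ) → ℝ≥0∞ := fun q => ENNReal.ofReal (envWeight D κ B v q)
  let Hit : Set (Fin n → Fin d → ℤ) := {q | ∃ j, q j = x}
  let Near : Set (Fin n → Fin d → ℤ) := {q | (∀ j, q j ≠ x) ∧ ∃ t, nsq (x - q t) = 1}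
  have hchoice : ∀ q : Near, ∃ t, nsq (x - q.1 t) = 1 := fun q => q.2.2
  choose τ hτ using hchoice
  let move : Near → Hit × unitVectors d := fun q =>
    (⟨Function.update q.1 (τ q) x, τ q, by simp⟩, ⟨x - q.1 (τ q), mem_unitVectors (hτ q)⟩)
  have hmove : Function.Injective move := by
    intro q r hqr
    have h1 : Function.update q.1 (τ q) x = Function.update r.1 (τ r) x :=
      congrArg (fun z => z.1.1) hqr
    have h2 : x - q.1 (τ q) = x - r.1 (τ r) := congrArg (fun z => z.2.1) hqr
    have ht : τ q = τ r := by
      by_contra hne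
      have := congrFun h1 (τ q)
      rw [Function.update_self, Function.update_of_ne hne] at this
      exact r.2.1 _ this.symm
    refine Subtype.ext (funext fun j => ?_)
    by_cases hj : j = τ q
    · rw [hj]
      nth_rewrite 2 [ht]
      exact sub_right_injective h2
    · have := congrFun h1 j
      rwa [Function.update_of_ne hj, Function.update_of_ne (ht ▸ hj)] at this
  have hbonus : ∑' q : Near, f (move q).1 ≤ (2 * d : ℕ) * ∑' q : Hit, f q := by
    calc ∑' q : Near, f (move q).1
        ≤ ∑' z : Hit × unitVectors d, f z.1 :=
          ENNReal.tsum_comp_le_tsum_of_injective hmove (fun z => f z.1)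
      _ = ∑' q : Hit, ((unitVectors d).card : ℝ≥0∞) * f q := by
          rw [ENNReal.tsum_prod']
          simp
      _ ≤ ∑' q : Hit, ((2 * d : ℕ) : ℝ≥0∞) * f q := by
          gcongr
          exact card_unitVectors_le
      _ = _ := ENNReal.tsum_mul_left
  let c : ℝ := 1 / (2 * d)
  have hc : 0 ≤ c := by positivity
  have hpt : ∀ q : (Hitᶜ : Set _), ENNReal.ofReal (envWeight D κ (insert x B) v q.1) ≤
      f q + Near.indicator (fun q => if h : q ∈ Near then
        ENNReal.ofReal c * f (move ⟨q, h⟩).1 else 0) q.1 := by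
    rintro ⟨q, hq⟩
    have hxq : ∀ j, q j ≠ x := fun j hj => hq ⟨j, hj⟩
    have hfn := envWeight_nonneg hκ hDnn B v q
    rw [envWeight_insert hxB]
    by_cases hnear : ∃ t, nsq (x - q t) = 1
    · have hN : q ∈ Near := ⟨hxq, hnear⟩
      rw [Set.indicator_of_mem hN, dif_pos hN, ← ENNReal.ofReal_mul hc, ← ENNReal.ofReal_add hfn
        (mul_nonneg hc (envWeight_nonneg hκ hDnn B v _))]
      refine ENNReal.ofReal_le_ofReal ?_
      have hupd := envWeight_le_update hκ hDnn hΔpos hΔ1 hΔ (τ ⟨q, hN⟩) hvB hxB hxq (hτ ⟨q, hN⟩)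
      have hprod : envWeight D κ B v q * ∏ j, pairFactor κ x (q j) ≤
          envWeight D κ B v q * (1 + κ) ^ (2 * d) := by
        by_cases h0 : envWeight D κ B v q = 0
        · simp [h0]
        · have hinj := injective_of_selfFactor_ne_zero
            (left_ne_zero_of_mul (right_ne_zero_of_mul h0))
          refine mul_le_mul_of_nonneg_left ?_ hfn
          simp only [pairFactor_comm x]
          rw [← Finset.prod_image (f := fun b => pairFactor κ b x) (g := q)
            (fun a _ b _ h => hinj h)]
          exact prod_pairFactor_le_pow hκ x _
      refine hprod.trans ((mul_le_mul_of_nonneg_left hsmall hfn).trans ?_)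
      rw [mul_add, mul_one]
      have : Δ ^ 2 / (2 * d * (1 + κ) ^ (2 * d - 1)) = c * (Δ ^ 2 / (1 + κ) ^ (2 * d - 1)) := by
        simp only [c]
        rw [div_mul_div_comm, one_mul]
      rw [this, mul_left_comm]
      exact add_le_add le_rfl (mul_le_mul_of_nonneg_left hupd hc)
    · refine le_add_right (ENNReal.ofReal_le_ofReal (mul_le_of_le_one_right hfn ?_))
      refine Finset.prod_le_one (fun j _ => pairFactor_nonneg hκ _ _) fun j _ => ?_
      refine (pairFactor_le _ _).trans ?_
      rw [if_neg fun h => hnear ⟨j, h⟩]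
  have hhit : ∀ q : Hit, ENNReal.ofReal (envWeight D κ (insert x B) v q.1) = 0 := by
    rintro ⟨q, j, hj⟩
    rw [envWeight_insert hxB, Finset.prod_eq_zero (Finset.mem_univ j), mul_zero,
      ENNReal.ofReal_zero]
    simp only [hj, pairFactor_self]
  rw [← ENNReal.summable.tsum_add_tsum_compl (s := Hit) ENNReal.summable,
    ← ENNReal.summable.tsum_add_tsum_compl (s := Hit) ENNReal.summable]
  simp only [hhit, tsum_zero, zero_add]
  refine (ENNReal.tsum_le_tsum hpt).trans ?_
  rw [ENNReal.tsum_add, add_comm]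
  refine add_le_add ?_ le_rfl
  calc _ ≤ ∑' q, Near.indicator (fun q => if h : q ∈ Near then
            ENNReal.ofReal c * f (move ⟨q, h⟩).1 else 0) q :=
          ENNReal.tsum_comp_le_tsum_of_injective Subtype.val_injective _
    _ = ∑' q : Near, ENNReal.ofReal c * f (move q).1 := by
          rw [← tsum_subtype]
          simp
    _ ≤ ENNReal.ofReal c * ((2 * d : ℕ) * ∑' q : Hit, f q) := by
          rw [ENNReal.tsum_mul_left]
          gcongr
    _ = ∑' q : Hit, f q := by
          rw [← mul_assoc, ← ENNReal.ofReal_natCast, ← ENNReal.ofReal_mul hc]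
          have : c * (2 * d : ℕ) = 1 := by
            have : (d : ℝ) ≠ 0 := by positivity
            simp only [c]
            push_cast
            field_simp
          rw [this, ENNReal.ofReal_one, one_mul]

lemma tsum_envWeight_le (hκ : 0 ≤ κ) (hDnn : ∀ x, 0 ≤ D x) (hΔpos : 0 < Δ) (hΔ1 : Δ ≤ 1)
    (hΔ : ∀ x y : Fin d → ℤ, nsq (x - y) = 1 → y ≠ 0 → Δ * D x ≤ D y) (hd : 0 < d)
    (hsmall : (1 + κ) ^ (2 * d) ≤ 1 + Δ ^ 2 / (2 * d * (1 + κ) ^ (2 * d - 1)))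
    {B : Finset (Fin d → ℤ)} {v : Fin d → ℤ} (hvB : v ∈ B) (n : ℕ) :
    ∑' q : Fin n → Fin d → ℤ, ENNReal.ofReal (envWeight D κ B v q) ≤
      ∑' q : Fin n → Fin d → ℤ, ENNReal.ofReal (envWeight D κ {v} v q) := by
  have key : ∀ A : Finset (Fin d → ℤ), v ∉ A →
      ∑' q : Fin n → Fin d → ℤ, ENNReal.ofReal (envWeight D κ (insert v A) v q) ≤
        ∑' q : Fin n → Fin d → ℤ, ENNReal.ofReal (envWeight D κ {v} v q) := by
    intro A
    induction A using Finset.induction with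
    | empty => intro _; simp
    | insert x A hxA ih =>
      intro hv
      simp only [Finset.mem_insert, not_or] at hv
      rw [Finset.insert_comm]
      exact (tsum_envWeight_insert_le hκ hDnn hΔpos hΔ1 hΔ hd hsmall (Finset.mem_insert_self _ _)
        (by simp [hxA, Ne.symm hv.1]) n).trans (ih hv.2)
  have := key (B.erase v) (Finset.notMem_erase _ _)
  rwa [Finset.insert_erase hvB] at this

end Steps

section Walks

open ENNReal

variable {d : ℕ} {D : (Fin d → ℤ) → ℝ} {κ Δ D1 : ℝ}

/-- The total connectivity `c_n` as an extended nonnegative real. -/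
noncomputable def walkSum (D : (Fin d → ℤ) → ℝ) (κ : ℝ) (n : ℕ) : ℝ≥0∞ :=
  ∑' p : Fin n → Fin d → ℤ, ENNReal.ofReal (envWeight D κ {0} 0 p)

lemma stepWeight_mul_pairWeight_cons (v : Fin d → ℤ) {n : ℕ} (p : Fin n → Fin d → ℤ) :
    stepWeight D (Fin.cons v p : Fin (n + 1) → Fin d → ℤ) *
      pairWeight κ (Fin.cons v p : Fin (n + 1) → Fin d → ℤ) = envWeight D κ {v} v p := by
  rw [pairWeight_eq_selfFactor, selfFactor_cons, envWeight, stepProd, mul_comm (envFactor _ _ _)]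

lemma pairWeight_nonneg (hκ : 0 ≤ κ) {n : ℕ} (w : Fin (n + 1) → Fin d → ℤ) :
    0 ≤ pairWeight κ w := by
  rw [pairWeight_eq_selfFactor]
  exact selfFactor_nonneg hκ w

lemma walkSum_eq_tsum_tsum (n : ℕ) :
    walkSum D κ n = ∑' x : Fin d → ℤ,
      ∑' w : {w : Fin (n + 1) → Fin d → ℤ // w 0 = 0 ∧ w (Fin.last n) = x},
        ENNReal.ofReal (stepWeight D w.1 * pairWeight κ w.1) := by
  rw [← ENNReal.tsum_sigma' (β := fun x : Fin d → ℤ =>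
    {w : Fin (n + 1) → Fin d → ℤ // w 0 = 0 ∧ w (Fin.last n) = x})
    fun z => ENNReal.ofReal (stepWeight D z.2.1 * pairWeight κ z.2.1)]
  let e : (Fin n → Fin d → ℤ) → Σ x : Fin d → ℤ,
      {w : Fin (n + 1) → Fin d → ℤ // w 0 = 0 ∧ w (Fin.last n) = x} := fun p =>
    ⟨_, (Fin.cons 0 p : Fin (n + 1) → Fin d → ℤ), rfl, rfl⟩
  have he : Function.Bijective e := by
    constructor
    · intro p q hpq
      have : (Fin.cons 0 p : Fin (n + 1) → Fin d → ℤ) = Fin.cons 0 q :=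
        congrArg (fun z => z.2.1) hpq
      exact Fin.cons_right_injective _ this
    · rintro ⟨x, w, h0, rfl⟩
      obtain ⟨p, rfl⟩ : ∃ p : Fin n → Fin d → ℤ,
          w = (Fin.cons 0 p : Fin (n + 1) → Fin d → ℤ) :=
        ⟨Fin.tail w, by rw [← h0, Fin.cons_self_tail]⟩
      exact ⟨p, rfl⟩
  rw [← (Equiv.ofBijective e he).tsum_eq, walkSum]
  refine tsum_congr fun p => ?_
  rw [← stepWeight_mul_pairWeight_cons]
  rfl

lemma totConn_eq_toReal (hκ : 0 ≤ κ) (hDnn : ∀ x, 0 ≤ D x) {n : ℕ} (hfin : walkSum D κ n ≠ ⊤) :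
    totConn D κ n = (walkSum D κ n).toReal := by
  rw [walkSum_eq_tsum_tsum] at hfin ⊢
  rw [ENNReal.tsum_toReal_eq fun x => ENNReal.ne_top_of_tsum_ne_top hfin x, totConn]
  refine tsum_congr fun x => ?_
  rw [ENNReal.tsum_toReal_eq fun _ => ENNReal.ofReal_ne_top, conn]
  exact tsum_congr fun w => (ENNReal.toReal_ofReal
    (mul_nonneg (stepWeight_nonneg hDnn _) (pairWeight_nonneg hκ _))).symm

lemma tsum_envWeight_singleton (v : Fin d → ℤ) (n : ℕ) :
    ∑' q : Fin n → Fin d → ℤ, ENNReal.ofReal (envWeight D κ {v} v q) = walkSum D κ n := by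
  rw [walkSum, ← (Equiv.addRight (fun _ : Fin n => v)).tsum_eq]
  refine tsum_congr fun q => ?_
  have h1 : (Equiv.addRight (fun _ : Fin n => v)) q = fun i => q i + v := rfl
  have h2 : ∀ a b : Fin d → ℤ, pairFactor κ (a + v) (b + v) = pairFactor κ a b := fun a b => by
    rw [pairFactor, add_sub_add_right_eq_sub, pairFactor]
  have h3 : ∀ b : Fin d → ℤ, pairFactor κ v (b + v) = pairFactor κ 0 b := fun b => by
    rw [← h2 0 b, zero_add]
  rw [h1, envWeight, envWeight, stepProd_add]
  simp only [selfFactor, envFactor, Finset.prod_singleton, h2, h3]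

lemma envWeight_append (m n : ℕ) (p : Fin m → Fin d → ℤ) (q : Fin n → Fin d → ℤ) :
    envWeight D κ {0} 0 (Fin.append p q) = envWeight D κ {0} 0 p *
      envWeight D κ (Finset.univ.image (Fin.cons 0 p : Fin (m + 1) → Fin d → ℤ))
        ((Fin.cons 0 p : Fin (m + 1) → Fin d → ℤ) (Fin.last m)) q := by
  by_cases h0 : selfFactor κ (Fin.cons 0 p : Fin (m + 1) → Fin d → ℤ) = 0
  · rw [selfFactor_cons] at h0
    have h1 : envFactor κ {0} (Fin.append p q) = envFactor κ {0} p * envFactor κ {0} q := by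
      simp [envFactor, Fin.prod_univ_add]
    rw [envWeight, envWeight, selfFactor_append, h1]
    linear_combination (stepProd D 0 (Fin.append p q) * (∏ i, ∏ j, pairFactor κ (p i) (q j)) *
      selfFactor κ q * envFactor κ {0} q - stepProd D 0 p * envWeight D κ (Finset.univ.image
        (Fin.cons 0 p : Fin (m + 1) → Fin d → ℤ))
        ((Fin.cons 0 p : Fin (m + 1) → Fin d → ℤ) (Fin.last m)) q) * h0
  · have hinj := injective_of_selfFactor_ne_zero h0
    rw [envWeight, envWeight, envWeight, selfFactor_append, stepProd_append]
    simp only [envFactor]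
    rw [Finset.prod_image fun a _ b _ h => hinj h]
    simp only [Fin.prod_univ_succ, Fin.cons_zero, Fin.cons_succ, Finset.prod_singleton,
      Fin.prod_univ_add, Fin.append_left, Fin.append_right]
    ring

lemma walkSum_add_le (hκ : 0 ≤ κ) (hDnn : ∀ x, 0 ≤ D x) (hΔpos : 0 < Δ) (hΔ1 : Δ ≤ 1)
    (hΔ : ∀ x y : Fin d → ℤ, nsq (x - y) = 1 → y ≠ 0 → Δ * D x ≤ D y) (hd : 0 < d)
    (hsmall : (1 + κ) ^ (2 * d) ≤ 1 + Δ ^ 2 / (2 * d * (1 + κ) ^ (2 * d - 1))) (m n : ℕ) :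
    walkSum D κ (m + n) ≤ walkSum D κ m * walkSum D κ n := by
  rw [walkSum, ← (Fin.appendEquiv m n).tsum_eq, ENNReal.tsum_prod', walkSum,
    ← ENNReal.tsum_mul_right]
  refine ENNReal.tsum_le_tsum fun p => ?_
  have h1 : ∀ q : Fin n → Fin d → ℤ, Fin.appendEquiv m n (p, q) = Fin.append p q := fun _ => rfl
  simp only [h1, envWeight_append, ENNReal.ofReal_mul (envWeight_nonneg hκ hDnn {0} 0 p)]
  rw [ENNReal.tsum_mul_left, ← tsum_envWeight_singleton
    ((Fin.cons 0 p : Fin (m + 1) → Fin d → ℤ) (Fin.last m)) n]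
  exact mul_le_mul' le_rfl (tsum_envWeight_le hκ hDnn hΔpos hΔ1 hΔ hd hsmall
    (Finset.mem_image.2 ⟨Fin.last m, Finset.mem_univ _, rfl⟩) n)

lemma walkSum_zero : walkSum D κ 0 = 1 := by
  rw [walkSum, tsum_fintype]
  simp [envWeight, stepProd_eq, selfFactor, envFactor]

lemma walkSum_one_le (hκ : 0 ≤ κ) (hDnn : ∀ x, 0 ≤ D x) (hsum : HasSum D 1)
    (hD1 : ∀ x : Fin d → ℤ, nsq x = 1 → D x = D1) (hD1nn : 0 ≤ D1) :
    walkSum D κ 1 ≤ ENNReal.ofReal (1 + 2 * d * κ * D1) := by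
  have hpt : ∀ x : Fin d → ℤ, ENNReal.ofReal (envWeight D κ {0} 0 fun _ : Fin 1 => x) ≤
      ENNReal.ofReal (D x) + if x ∈ unitVectors d then ENNReal.ofReal (κ * D1) else 0 := by
    intro x
    have h1 : envWeight D κ {0} 0 (fun _ : Fin 1 => x) = D x * pairFactor κ x 0 := by
      rw [pairFactor_comm]
      simp [envWeight, stepProd_eq, selfFactor, envFactor]
    rw [h1]
    have h2 := pairFactor_le (κ := κ) x 0
    rw [sub_zero] at h2
    by_cases hx : nsq x = 1
    · rw [if_pos hx] at h2
      rw [if_pos (mem_unitVectors hx), ← ENNReal.ofReal_add (hDnn x) (by positivity)]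
      refine ENNReal.ofReal_le_ofReal ((mul_le_mul_of_nonneg_left h2 (hDnn x)).trans ?_)
      rw [hD1 x hx]
      linarith
    · rw [if_neg hx] at h2
      exact le_add_right (ENNReal.ofReal_le_ofReal (mul_le_of_le_one_right (hDnn x) h2))
  have hequiv : walkSum D κ 1 =
      ∑' x : Fin d → ℤ, ENNReal.ofReal (envWeight D κ {0} 0 fun _ : Fin 1 => x) := by
    rw [walkSum, ← (Equiv.funUnique (Fin 1) (Fin d → ℤ)).symm.tsum_eq]
    rfl
  rw [hequiv]
  refine (ENNReal.tsum_le_tsum hpt).trans ?_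
  rw [ENNReal.tsum_add, ← ENNReal.ofReal_tsum_of_nonneg hDnn hsum.summable, hsum.tsum_eq,
    tsum_eq_sum (s := unitVectors d) fun x hx => if_neg hx, Finset.sum_ite_mem, Finset.inter_self,
    Finset.sum_const, nsmul_eq_mul, mul_assoc (2 * (d : ℝ)),
    ENNReal.ofReal_add zero_le_one (by positivity)]
  refine add_le_add le_rfl ?_
  have : (2 * (d : ℝ)) = ((2 * d : ℕ) : ℝ) := by push_cast; rfl
  rw [this, ENNReal.ofReal_mul (p := ((2 * d : ℕ) : ℝ)) (by positivity), ENNReal.ofReal_natCast]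
  gcongr
  exact card_unitVectors_le

/-- The restriction of the step weight to the closed positive orthant. -/
noncomputable def orthantStep (D : (Fin d → ℤ) → ℝ) : (Fin d → ℤ) → ℝ :=
  {x | 0 ≤ x}.indicator D

lemma orthantStep_nonneg (hDnn : ∀ x, 0 ≤ D x) (x : Fin d → ℤ) : 0 ≤ orthantStep D x :=
  Set.indicator_nonneg (fun x _ => hDnn x) x

lemma orthantStep_le (hDnn : ∀ x, 0 ≤ D x) (x : Fin d → ℤ) : orthantStep D x ≤ D x :=
  Set.indicator_le_self' (fun x _ => hDnn x) x

lemma tsum_stepProd (hDnn : ∀ x, 0 ≤ D x) (n : ℕ) (v : Fin d → ℤ) :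
    ∑' q : Fin n → Fin d → ℤ, ENNReal.ofReal (stepProd D v q) =
      (∑' x, ENNReal.ofReal (D x)) ^ n := by
  induction n generalizing v with
  | zero => rw [tsum_fintype]; simp [stepProd_eq]
  | succ n ih =>
    rw [← (Fin.consEquiv fun _ : Fin (n + 1) => Fin d → ℤ).tsum_eq, ENNReal.tsum_prod']
    have h1 : ∀ (x : Fin d → ℤ) (q : Fin n → Fin d → ℤ),
        (Fin.consEquiv fun _ : Fin (n + 1) => Fin d → ℤ) (x, q) = Fin.cons x q := fun _ _ => rfl
    simp only [h1, stepProd_cons, ENNReal.ofReal_mul (hDnn _), ENNReal.tsum_mul_left, ih,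
      ENNReal.tsum_mul_right]
    rw [pow_succ', ← (Equiv.subRight v).tsum_eq fun x => ENNReal.ofReal (D x)]
    rfl

lemma stepProd_orthantStep_le (hκ : 0 ≤ κ) (hDnn : ∀ x, 0 ≤ D x) (hD0 : D 0 = 0) {n : ℕ}
    (p : Fin n → Fin d → ℤ) :
    stepProd (orthantStep D) 0 p ≤ envWeight D κ {0} 0 p := by
  by_cases h0 : stepProd (orthantStep D) 0 p = 0
  · rw [h0]
    exact envWeight_nonneg hκ hDnn _ _ _
  have hmono : StrictMono (Fin.cons 0 p : Fin (n + 1) → Fin d → ℤ) := by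
    rw [Fin.strictMono_iff_lt_succ]
    intro i
    rw [stepProd, stepWeight] at h0
    have hi := Finset.prod_ne_zero_iff.1 h0 i (Finset.mem_univ i)
    have hmem := Set.mem_of_indicator_ne_zero hi
    refine lt_of_le_of_ne (sub_nonneg.1 hmem) fun heq => hi ?_
    rw [heq, sub_self, orthantStep, Set.indicator_of_mem (by simp), hD0]
  have hle : stepProd (orthantStep D) 0 p ≤ stepProd D 0 p := by
    rw [stepProd_eq, stepProd_eq]
    exact Finset.prod_le_prod (fun _ _ => orthantStep_nonneg hDnn _)
      fun _ _ => orthantStep_le hDnn _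
  refine hle.trans ?_
  rw [← stepWeight_mul_pairWeight_cons, pairWeight_eq_selfFactor]
  exact le_mul_of_one_le_right (stepProd_nonneg hDnn _ _) (one_le_selfFactor hκ hmono.injective)

lemma one_le_two_pow_mul_tsum_orthantStep (hDnn : ∀ x, 0 ≤ D x) (hsum : HasSum D 1)
    (hsymm : LatticeSymm D) : 1 ≤ 2 ^ d * ∑' x, ENNReal.ofReal (orthantStep D x) := by
  classical
  let sgn : (Fin d → Bool) → Fin d → ℤ := fun ε i => if ε i then 1 else -1
  have hsgn : ∀ ε i, sgn ε i = 1 ∨ sgn ε i = -1 := fun ε i => by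
    simp only [sgn]; split_ifs <;> simp
  let flip : (Fin d → Bool) → Equiv.Perm (Fin d → ℤ) := fun ε =>
    Function.Involutive.toPerm (fun x => sgn ε * x) fun x => by
      funext i
      rcases hsgn ε i with h | h <;> simp [h]
  have hflip : ∀ ε x, D (flip ε x) = D x := fun ε x => hsymm (Equiv.refl _) (sgn ε) (hsgn ε) x
  calc (1 : ℝ≥0∞) = ∑' x, ENNReal.ofReal (D x) := by
        rw [← ENNReal.ofReal_tsum_of_nonneg hDnn hsum.summable, hsum.tsum_eq, ENNReal.ofReal_one]
    _ ≤ ∑' x, ∑ ε : Fin d → Bool, ENNReal.ofReal (orthantStep D (flip ε x)) := by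
        refine ENNReal.tsum_le_tsum fun x => ?_
        let ε : Fin d → Bool := fun i => decide (0 ≤ x i)
        have hpos : flip ε x ∈ {x : Fin d → ℤ | 0 ≤ x} := fun i => by
          change 0 ≤ (if decide (0 ≤ x i) = true then (1 : ℤ) else -1) * x i
          by_cases hx : 0 ≤ x i
          · simp [hx]
          · simp only [hx, decide_false, Bool.false_eq_true, if_false]
            omega
        have : orthantStep D (flip ε x) = D x := by
          rw [orthantStep, Set.indicator_of_mem hpos, hflip]
        rw [← this]
        exact Finset.single_le_sum (f := fun ε => ENNReal.ofReal (orthantStep D (flip ε x)))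
          (fun _ _ => zero_le) (Finset.mem_univ ε)
    _ = ∑ ε : Fin d → Bool, ∑' x, ENNReal.ofReal (orthantStep D (flip ε x)) :=
        Summable.tsum_finsetSum fun _ _ => ENNReal.summable
    _ = ∑ ε : Fin d → Bool, ∑' x, ENNReal.ofReal (orthantStep D x) :=
        Finset.sum_congr rfl fun ε _ =>
          (flip ε).tsum_eq fun x => ENNReal.ofReal (orthantStep D x)
    _ = 2 ^ d * ∑' x, ENNReal.ofReal (orthantStep D x) := by simp

lemma inv_two_pow_pow_le_walkSum (hκ : 0 ≤ κ) (hDnn : ∀ x, 0 ≤ D x) (hD0 : D 0 = 0)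
    (hsum : HasSum D 1) (hsymm : LatticeSymm D) (n : ℕ) :
    ENNReal.ofReal (((2 : ℝ) ^ d)⁻¹ ^ n) ≤ walkSum D κ n := by
  have h1 : ENNReal.ofReal ((2 : ℝ) ^ d)⁻¹ ≤ ∑' x, ENNReal.ofReal (orthantStep D x) := by
    rw [ENNReal.ofReal_inv_of_pos (by positivity), ENNReal.ofReal_pow (by positivity),
      ENNReal.ofReal_ofNat]
    rw [ENNReal.inv_le_iff_le_mul (by simp) (by simp)]
    exact one_le_two_pow_mul_tsum_orthantStep hDnn hsum hsymm
  rw [ENNReal.ofReal_pow (by positivity)]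
  refine (pow_le_pow_left' h1 n).trans ?_
  rw [← tsum_stepProd (orthantStep_nonneg hDnn) n 0]
  exact ENNReal.tsum_le_tsum fun p =>
    ENNReal.ofReal_le_ofReal (stepProd_orthantStep_le hκ hDnn hD0 p)

end Walks

/-- A submultiplicative sequence with `a ^ n ≤ c n` has a limiting growth rate. -/
lemma exists_tendsto_rpow_inv_of_submultiplicative {c : ℕ → ℝ} {a : ℝ} (ha : 0 < a)
    (hlow : ∀ n, a ^ n ≤ c n) (hmul : ∀ m n, c (m + n) ≤ c m * c n) :
    ∃ μ : ℝ, Filter.Tendsto (fun n : ℕ => c n ^ ((1 : ℝ) / n)) Filter.atTop (nhds μ) ∧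
      a ≤ μ ∧ μ ≤ c 1 := by
  have hpos : ∀ n, 0 < c n := fun n => (pow_pos ha n).trans_le (hlow n)
  have hsub : Subadditive fun n => Real.log (c n) := fun m n => by
    rw [← Real.log_mul (hpos m).ne' (hpos n).ne']
    exact Real.log_le_log (hpos _) (hmul m n)
  have hlog : ∀ n : ℕ, n * Real.log a ≤ Real.log (c n) := fun n => by
    rw [← Real.log_pow]
    exact Real.log_le_log (pow_pos ha n) (hlow n)
  have hlog' : ∀ n : ℕ, n ≠ 0 → Real.log a ≤ Real.log (c n) / n := fun n hn => by
    rw [le_div_iff₀ (by positivity), mul_comm]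
    exact hlog n
  have hbdd : BddBelow (Set.range fun n : ℕ => Real.log (c n) / n) := by
    refine ⟨min (Real.log a) 0, ?_⟩
    rintro _ ⟨n, rfl⟩
    by_cases hn : n = 0
    · subst hn; simp
    · exact (min_le_left _ _).trans (hlog' n hn)
  have hlim := hsub.tendsto_lim hbdd
  have hev : (fun n : ℕ => c n ^ ((1 : ℝ) / n)) = fun n : ℕ => Real.exp (Real.log (c n) / n) := by
    funext n
    rw [Real.rpow_def_of_pos (hpos n), mul_one_div]
  refine ⟨Real.exp hsub.lim, ?_, ?_, ?_⟩
  · rw [hev]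
    exact (Real.continuous_exp.tendsto _).comp hlim
  · rw [← Real.log_le_iff_le_exp ha]
    refine ge_of_tendsto hlim (Filter.eventually_atTop.2 ⟨1, fun n hn => hlog' n (by omega)⟩)
  · rw [← Real.le_log_iff_exp_le (hpos 1)]
    simpa using hsub.lim_le_div hbdd one_ne_zero

/-- under the smallness condition
`(1+κ)^(2d) ≤ 1 + Δ²/(2d(1+κ)^(2d-1))` the sequence `c_n` is submultiplicative,
and consequently `c_n^(1/n)` converges to a limit `μ` with
`2^{-d} ≤ μ ≤ c₁ = 1 + 2dκD(1)`. Here `Δ > 0` is a lower bound for the ratios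
`D(y)/D(x)` over `|x-y| = 1`, `y ≠ 0`. -/
theorem submultiplicativity_and_connective_constant
    (d : ℕ) (hd : 0 < d) (D : (Fin d → ℤ) → ℝ) (κ Δ D1 : ℝ)
    (hκ : 0 ≤ κ) (hDnn : ∀ x, 0 ≤ D x) (hD0 : D 0 = 0)
    (hsum : HasSum D 1) (hsymm : LatticeSymm D)
    (hD1 : ∀ x : Fin d → ℤ, nsq x = 1 → D x = D1)
    (hΔpos : 0 < Δ)
    (hΔ : ∀ x y : Fin d → ℤ, nsq (x - y) = 1 → y ≠ 0 → Δ * D x ≤ D y)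
    (hsmall : (1 + κ) ^ (2 * d) ≤ 1 + Δ ^ 2 / (2 * d * (1 + κ) ^ (2 * d - 1))) :
    (∀ m n : ℕ, 1 ≤ m → 1 ≤ n → totConn D κ (m + n) ≤ totConn D κ m * totConn D κ n) ∧
    ∃ μ : ℝ, Filter.Tendsto (fun n : ℕ => (totConn D κ n) ^ ((1 : ℝ) / n))
        Filter.atTop (nhds μ) ∧
      ((2 : ℝ) ^ d)⁻¹ ≤ μ ∧ μ ≤ 1 + 2 * d * κ * D1 := by
  have hΔ1 := step_ratio_le_one hd hDnn hD0 hsum hΔpos hΔ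
  have hD1nn : 0 ≤ D1 := by
    have h : nsq (Pi.single (⟨0, hd⟩ : Fin d) (1 : ℤ)) = 1 := by
      rw [nsq, Finset.sum_eq_single ⟨0, hd⟩] <;> simp_all
    rw [← hD1 _ h]
    exact hDnn _
  have hadd := walkSum_add_le hκ hDnn hΔpos hΔ1 hΔ hd hsmall
  have hone := walkSum_one_le hκ hDnn hsum hD1 hD1nn
  have hfin : ∀ n, walkSum D κ n ≠ ⊤ := by
    intro n
    induction n with
    | zero => simp [walkSum_zero]
    | succ n ih =>
      exact ne_top_of_le_ne_top
        (ENNReal.mul_ne_top ih (ne_top_of_le_ne_top ENNReal.ofReal_ne_top hone)) (hadd n 1)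
  have htot : ∀ n, totConn D κ n = (walkSum D κ n).toReal := fun n =>
    totConn_eq_toReal hκ hDnn (hfin n)
  have hmul : ∀ m n, totConn D κ (m + n) ≤ totConn D κ m * totConn D κ n := fun m n => by
    rw [htot, htot, htot, ← ENNReal.toReal_mul]
    exact ENNReal.toReal_mono (ENNReal.mul_ne_top (hfin m) (hfin n)) (hadd m n)
  have hlow : ∀ n, ((2 : ℝ) ^ d)⁻¹ ^ n ≤ totConn D κ n := fun n => by
    rw [htot, ← ENNReal.ofReal_le_iff_le_toReal (hfin n)]
    exact inv_two_pow_pow_le_walkSum hκ hDnn hD0 hsum hsymm n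
  obtain ⟨μ, hμ, hμlow, hμle⟩ :=
    exists_tendsto_rpow_inv_of_submultiplicative (by positivity) hlow hmul
  refine ⟨fun m n _ _ => hmul m n, μ, hμ, hμlow, hμle.trans ?_⟩
  rw [htot]
  exact ENNReal.toReal_le_of_le_ofReal (by positivity) hone
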